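/- arXiv:math/0409284 — 9 statements merged into one kernel-verified Lean document; each statement's English description precedes it below -/
import Mathlib

section
/- For every w ∈ FreeGroup (Fin 2) there exists a polynomial f ∈ MvPolynomial (Fin 3) ℤ such that for every field K and all matrices A, B ∈ Matrix.SpecialLinearGroup (Fin 2) K, the trace of w(A,B) equals the evaluation of f (with its integer coefficients mapped into K) at the triple (trace A, trace B, trace (A*B)). -/
open Matrix MvPolynomial in
/-- The quadruples of trace polynomials that express `w(A, B)` as a linear combination of
`1`, `A`, `B` and `A * B`, uniformly in the field and in `A`, `B`. -/
def IsTraceCombination (w : FreeGroup (Fin 2)) (p q r s : MvPolynomial (Fin 3) ℤ) : Prop :=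
  ∀ (K : Type) [Field K] (A B : SpecialLinearGroup (Fin 2) K),
    let e := eval₂ (Int.castRingHom K)
      ![trace (A : Matrix (Fin 2) (Fin 2) K), trace (B : Matrix (Fin 2) (Fin 2) K),
        trace ((A * B : SpecialLinearGroup (Fin 2) K) : Matrix (Fin 2) (Fin 2) K)]
    ((FreeGroup.lift ![A, B] w : SpecialLinearGroup (Fin 2) K) : Matrix (Fin 2) (Fin 2) K) =
      e p • (1 : Matrix (Fin 2) (Fin 2) K) + e q • (A : Matrix (Fin 2) (Fin 2) K) +
        e r • (B : Matrix (Fin 2) (Fin 2) K) +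
        e s • ((A : Matrix (Fin 2) (Fin 2) K) * (B : Matrix (Fin 2) (Fin 2) K))

/-- The Cayley–Hamilton relation for a `2 × 2` matrix of determinant one. -/
theorem Matrix.mul_self_eq_of_det_eq_one {R : Type*} [CommRing R] (A : Matrix (Fin 2) (Fin 2) R)
    (hA : A.det = 1) : A * A = A.trace • A - 1 := by
  rw [det_fin_two] at hA
  ext i j
  fin_cases i <;> fin_cases j <;> simp [mul_apply, trace_fin_two] <;>
    first | ring1 | linear_combination -hA

/-- The polarized Cayley–Hamilton relation for `2 × 2` matrices. -/
theorem Matrix.mul_swap_fin_two {R : Type*} [CommRing R] (A B : Matrix (Fin 2) (Fin 2) R) :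
    B * A = ((A * B).trace - A.trace * B.trace) • (1 : Matrix (Fin 2) (Fin 2) R) +
      B.trace • A + A.trace • B - A * B := by
  ext i j
  fin_cases i <;> fin_cases j <;> simp [mul_apply, trace_fin_two] <;> ring

/-- In an algebra generated by two elements satisfying the Cayley–Hamilton relations of a pair in
`SL₂`, the span of `1`, `A`, `B`, `A * B` is closed under multiplication. -/
theorem linearCombination_mul_of_relations {R S : Type*} [CommRing R] [Ring S] [Algebra R S]
    {A B : S} {x y z : R} (hA : A * A = x • A - 1) (hB : B * B = y • B - 1)
    (hBA : B * A = (z - x * y) • (1 : S) + y • A + x • B - A * B) (p q r s p' q' r' s' : R) :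
    (p • (1 : S) + q • A + r • B + s • (A * B)) *
        (p' • (1 : S) + q' • A + r' • B + s' • (A * B)) =
      (p * p' - q * q' + r * q' * (z - x * y) - r * r' - r * s' * x - s * q' * y - s * s') •
          (1 : S) +
        (p * q' + q * p' + q * q' * x + r * q' * y + r * s' + s * q' * z - s * r') • A +
        (p * r' + r * p' - q * s' + r * q' * x + r * r' * y + r * s' * z + s * q') • B +
        (p * s' + s * p' + q * r' + q * s' * x - r * q' + s * r' * y + s * s' * z) •
          (A * B) := by
  have hAAB : A * (A * B) = x • (A * B) - B := by
    rw [← mul_assoc, hA, sub_mul, smul_mul_assoc, one_mul]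
  have hABB : A * B * B = y • (A * B) - A := by
    rw [mul_assoc, hB, mul_sub, mul_smul_comm, mul_one]
  have hBAB : B * (A * B) = z • B - x • (1 : S) + A := by
    rw [← mul_assoc, hBA]
    simp only [add_mul, sub_mul, smul_mul_assoc, one_mul, hB, hABB]
    module
  have hABA : A * B * A = z • A - y • (1 : S) + B := by
    rw [mul_assoc, hBA]
    simp only [mul_add, mul_sub, mul_smul_comm, mul_one, hA, hAAB]
    module
  have hABAB : A * B * (A * B) = z • (A * B) - 1 := by
    rw [← mul_assoc, hABA]
    simp only [add_mul, sub_mul, smul_mul_assoc, one_mul, hB]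
    module
  simp only [mul_add, add_mul, smul_mul_assoc, mul_smul_comm, one_mul, mul_one, hA, hB, hBA,
    hAAB, hABB, hBAB, hABA, hABAB]
  module

theorem IsTraceCombination.mul {v w : FreeGroup (Fin 2)}
    {p q r s p' q' r' s' : MvPolynomial (Fin 3) ℤ}
    (hv : IsTraceCombination v p q r s) (hw : IsTraceCombination w p' q' r' s') :
    ∃ p'' q'' r'' s'', IsTraceCombination (v * w) p'' q'' r'' s'' := by
  let x : MvPolynomial (Fin 3) ℤ := .X 0
  let y : MvPolynomial (Fin 3) ℤ := .X 1
  let z : MvPolynomial (Fin 3) ℤ := .X 2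
  refine ⟨p * p' - q * q' + r * q' * (z - x * y) - r * r' - r * s' * x - s * q' * y - s * s',
    p * q' + q * p' + q * q' * x + r * q' * y + r * s' + s * q' * z - s * r',
    p * r' + r * p' - q * s' + r * q' * x + r * r' * y + r * s' * z + s * q',
    p * s' + s * p' + q * r' + q * s' * x - r * q' + s * r' * y + s * s' * z, ?_⟩
  intro K _ A B e
  rw [map_mul, Matrix.SpecialLinearGroup.coe_mul, hv K A B, hw K A B,
    linearCombination_mul_of_relations
      (Matrix.mul_self_eq_of_det_eq_one _ A.det_coe) (Matrix.mul_self_eq_of_det_eq_one _ B.det_coe)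
      (Matrix.mul_swap_fin_two _ _)]
  simp [e, x, y, z, MvPolynomial.eval₂_sub]

theorem exists_isTraceCombination (w : FreeGroup (Fin 2)) :
    ∃ p q r s, IsTraceCombination w p q r s := by
  induction w using FreeGroup.induction_on with
  | C1 => exact ⟨1, 0, 0, 0, fun K _ A B => by simp⟩
  | of i =>
    fin_cases i
    · exact ⟨0, 1, 0, 0, fun K _ A B => by simp⟩
    · exact ⟨0, 0, 1, 0, fun K _ A B => by simp⟩
  | inv_of i _ =>
    have inv_eq {K : Type} [Field K] (A : Matrix.SpecialLinearGroup (Fin 2) K) :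
        ((A⁻¹ : Matrix.SpecialLinearGroup (Fin 2) K) : Matrix (Fin 2) (Fin 2) K) =
          Matrix.trace (A : Matrix (Fin 2) (Fin 2) K) • (1 : Matrix (Fin 2) (Fin 2) K) - A := by
      rw [Matrix.SpecialLinearGroup.coe_inv, Matrix.adjugate_fin_two]
      ext i j
      fin_cases i <;> fin_cases j <;> simp [Matrix.trace_fin_two]
    fin_cases i
    · exact ⟨.X 0, -1, 0, 0, fun K _ A B => by
        simp [inv_eq, MvPolynomial.eval₂_neg, sub_eq_add_neg, -Matrix.SpecialLinearGroup.coe_inv]⟩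
    · exact ⟨.X 1, 0, -1, 0, fun K _ A B => by
        simp [inv_eq, MvPolynomial.eval₂_neg, sub_eq_add_neg, -Matrix.SpecialLinearGroup.coe_inv]⟩
  | mul v w hv hw =>
    obtain ⟨p, q, r, s, hv⟩ := hv
    obtain ⟨p', q', r', s', hw⟩ := hw
    exact hv.mul hw

/-- Trace identities (Klein): for every word `w(x,y)` there is an integer polynomial
`f` in three variables such that `tr w(A,B) = f(tr A, tr B, tr AB)` for all
`A, B ∈ SL(2, K)` over any field `K`. -/
theorem trace_polynomial_identity (w : FreeGroup (Fin 2)) :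
    ∃ f : MvPolynomial (Fin 3) ℤ,
      ∀ (K : Type) [Field K] (A B : Matrix.SpecialLinearGroup (Fin 2) K),
        Matrix.trace
            ((FreeGroup.lift ![A, B] w : Matrix.SpecialLinearGroup (Fin 2) K) :
              Matrix (Fin 2) (Fin 2) K) =
          MvPolynomial.eval₂ (Int.castRingHom K)
            ![Matrix.trace (A : Matrix (Fin 2) (Fin 2) K),
              Matrix.trace (B : Matrix (Fin 2) (Fin 2) K),
              Matrix.trace ((A * B : Matrix.SpecialLinearGroup (Fin 2) K) :
                Matrix (Fin 2) (Fin 2) K)] f := by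
  obtain ⟨p, q, r, s, h⟩ := exists_isTraceCombination w
  refine ⟨p * 2 + q * .X 0 + r * .X 1 + s * .X 2, fun K _ A B => ?_⟩
  rw [h K A B]
  simp
end

section
/- Let K be a field, let w ∈ FreeGroup (Fin 2), and let A, B ∈ GL (Fin 2) K be arbitrary invertible 2×2 matrices over K. Then the trace of w(A,B) equals the trace of w^R(A,B). -/
/-- The palindromic reverse `w^R = (σ w)⁻¹` of a word `w ∈ F(x,y)`, where `σ` sends each
generator to its inverse: the word `w` read backwards without inverting its letters. -/
def palRev (w : FreeGroup (Fin 2)) : FreeGroup (Fin 2) :=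
  (FreeGroup.lift (fun i : Fin 2 => (FreeGroup.of i)⁻¹) w)⁻¹

open Matrix

/-- The pairs `(f(A,B), f^R(A,B))`, where `f` runs over the linear combinations of the words
`1`, `x`, `y` and `xy`. -/
def reversalPairs {R : Type*} [CommRing R] (A B : Matrix (Fin 2) (Fin 2) R) :
    Submodule R (Matrix (Fin 2) (Fin 2) R × Matrix (Fin 2) (Fin 2) R) :=
  Submodule.span R {(1, 1), (A, A), (B, B), (A * B, B * A)}

section reversalPairs

variable {R : Type*} [CommRing R] (A B : Matrix (Fin 2) (Fin 2) R)

theorem one_mem_reversalPairs : (1, 1) ∈ reversalPairs A B :=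
  Submodule.subset_span (by simp)

theorem left_mem_reversalPairs : (A, A) ∈ reversalPairs A B :=
  Submodule.subset_span (by simp)

theorem right_mem_reversalPairs : (B, B) ∈ reversalPairs A B :=
  Submodule.subset_span (by simp)

theorem mul_mem_reversalPairs : (A * B, B * A) ∈ reversalPairs A B :=
  Submodule.subset_span (by simp)

theorem mul_self_eq_trace_smul_sub_det_smul_one : A * A = A.trace • A - A.det • 1 := by
  ext i j
  fin_cases i <;> fin_cases j <;>
    simp [Matrix.mul_apply, Matrix.trace_fin_two, Matrix.det_fin_two] <;> ring

theorem mul_swap_eq_sub_mul :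
    B * A = (trace (A * B) - A.trace * B.trace) • 1 + B.trace • A + A.trace • B - A * B := by
  ext i j
  fin_cases i <;> fin_cases j <;>
    simp [Matrix.mul_apply, Matrix.trace_fin_two] <;> ring

theorem swap_mem_reversalPairs : (B * A, A * B) ∈ reversalPairs A B := by
  convert sub_mem (add_mem (add_mem
    (Submodule.smul_mem _ (trace (A * B) - A.trace * B.trace) (one_mem_reversalPairs A B))
    (Submodule.smul_mem _ B.trace (left_mem_reversalPairs A B)))
    (Submodule.smul_mem _ A.trace (right_mem_reversalPairs A B)))
    (mul_mem_reversalPairs A B) using 1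
  refine Prod.ext (mul_swap_eq_sub_mul A B) ?_
  change A * B = (trace (A * B) - A.trace * B.trace) • 1 + B.trace • A + A.trace • B - B * A
  rw [mul_swap_eq_sub_mul A B]
  abel

theorem reversalPairs_swap_le : reversalPairs B A ≤ reversalPairs A B := by
  refine Submodule.span_le.2 ?_
  rintro _ (rfl | rfl | rfl | rfl)
  exacts [one_mem_reversalPairs A B, right_mem_reversalPairs A B, left_mem_reversalPairs A B,
    swap_mem_reversalPairs A B]

theorem reversalPairs_comm : reversalPairs B A = reversalPairs A B :=
  le_antisymm (reversalPairs_swap_le A B) (reversalPairs_swap_le B A)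

variable {A B}

theorem left_mul_mem_reversalPairs {x : Matrix (Fin 2) (Fin 2) R × Matrix (Fin 2) (Fin 2) R}
    (hx : x ∈ reversalPairs A B) : (A * x.1, x.2 * A) ∈ reversalPairs A B := by
  induction hx using Submodule.span_induction with
  | mem x hx =>
    obtain rfl | rfl | rfl | rfl := hx
    · simpa using left_mem_reversalPairs A B
    · convert sub_mem (Submodule.smul_mem _ A.trace (left_mem_reversalPairs A B))
        (Submodule.smul_mem _ A.det (one_mem_reversalPairs A B)) using 1
      exact Prod.ext (mul_self_eq_trace_smul_sub_det_smul_one A)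
        (mul_self_eq_trace_smul_sub_det_smul_one A)
    · exact mul_mem_reversalPairs A B
    · convert sub_mem (Submodule.smul_mem _ A.trace (mul_mem_reversalPairs A B))
        (Submodule.smul_mem _ A.det (right_mem_reversalPairs A B)) using 1
      ext1
      · simp [← mul_assoc, mul_self_eq_trace_smul_sub_det_smul_one A, sub_mul]
      · simp [mul_assoc, mul_self_eq_trace_smul_sub_det_smul_one A, mul_sub]
  | zero => simp [← Prod.zero_eq_mk]
  | add x y _ _ hx hy => simpa [mul_add, add_mul] using add_mem hx hy
  | smul r x _ hx => simpa using Submodule.smul_mem _ r hx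

theorem right_mul_mem_reversalPairs {x : Matrix (Fin 2) (Fin 2) R × Matrix (Fin 2) (Fin 2) R}
    (hx : x ∈ reversalPairs A B) : (B * x.1, x.2 * B) ∈ reversalPairs A B := by
  rw [← reversalPairs_comm] at hx ⊢
  exact left_mul_mem_reversalPairs hx

theorem trace_eq_of_mem_reversalPairs
    {x : Matrix (Fin 2) (Fin 2) R × Matrix (Fin 2) (Fin 2) R}
    (hx : x ∈ reversalPairs A B) : x.1.trace = x.2.trace := by
  induction hx using Submodule.span_induction with
  | mem x hx =>
    obtain rfl | rfl | rfl | rfl := hx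
    exacts [rfl, rfl, rfl, trace_mul_comm A B]
  | zero => rfl
  | add x y _ _ hx hy => simp [hx, hy]
  | smul r x _ hx => simp [hx]

theorem coe_inv_eq_smul_trace_smul_one_sub (C : GL (Fin 2) R) :
    ((C⁻¹ : GL (Fin 2) R) : Matrix (Fin 2) (Fin 2) R) =
      Ring.inverse C.val.det • (C.val.trace • 1 - C.val) := by
  rw [coe_units_inv, inv_def, adjugate_fin_two]
  congr 1
  ext i j
  fin_cases i <;> fin_cases j <;> simp [trace_fin_two]

theorem inv_mul_mem_of_mul_mem
    {S : Submodule R (Matrix (Fin 2) (Fin 2) R × Matrix (Fin 2) (Fin 2) R)} (C : GL (Fin 2) R)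
    {x : Matrix (Fin 2) (Fin 2) R × Matrix (Fin 2) (Fin 2) R} (hx : x ∈ S)
    (h : (C.val * x.1, x.2 * C.val) ∈ S) :
    ((C⁻¹ : GL (Fin 2) R).val * x.1, x.2 * (C⁻¹ : GL (Fin 2) R).val) ∈ S := by
  convert Submodule.smul_mem _ (Ring.inverse C.val.det)
    (sub_mem (Submodule.smul_mem _ C.val.trace hx) h) using 1
  rw [coe_inv_eq_smul_trace_smul_one_sub]
  ext1 <;> simp [sub_mul, mul_sub]

end reversalPairs

theorem palRev_of (i : Fin 2) : palRev (FreeGroup.of i) = FreeGroup.of i := by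
  simp [palRev]

theorem palRev_inv (w : FreeGroup (Fin 2)) : palRev w⁻¹ = (palRev w)⁻¹ := by
  simp [palRev]

theorem palRev_mul (v w : FreeGroup (Fin 2)) : palRev (v * w) = palRev w * palRev v := by
  simp [palRev]

theorem lift_mul_mem_reversalPairs {R : Type*} [CommRing R] (A B : GL (Fin 2) R)
    (w : FreeGroup (Fin 2)) {x : Matrix (Fin 2) (Fin 2) R × Matrix (Fin 2) (Fin 2) R}
    (hx : x ∈ reversalPairs A.val B.val) :
    ((FreeGroup.lift ![A, B] w).val * x.1, x.2 * (FreeGroup.lift ![A, B] (palRev w)).val) ∈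
      reversalPairs A.val B.val := by
  have of_mul_mem (i : Fin 2) {x : Matrix (Fin 2) (Fin 2) R × Matrix (Fin 2) (Fin 2) R}
      (hx : x ∈ reversalPairs A.val B.val) :
      ((![A, B] i).val * x.1, x.2 * (![A, B] i).val) ∈ reversalPairs A.val B.val := by
    fin_cases i
    exacts [left_mul_mem_reversalPairs hx, right_mul_mem_reversalPairs hx]
  induction w using FreeGroup.induction_on generalizing x with
  | C1 => simpa [palRev] using hx
  | of i =>
    rw [palRev_of, FreeGroup.lift_apply_of]
    exact of_mul_mem i hx
  | inv_of i _ =>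
    rw [palRev_inv, palRev_of, map_inv, FreeGroup.lift_apply_of]
    exact inv_mul_mem_of_mul_mem _ hx (of_mul_mem i hx)
  | mul v w hv hw =>
    rw [palRev_mul, map_mul, map_mul, Units.val_mul, Units.val_mul, mul_assoc,
      ← mul_assoc x.2]
    exact hv (hw hx)

/-- For any field `K`, any word `w` and any `A, B ∈ GL(2, K)`,
`tr w(A,B) = tr w^R(A,B)`. -/
theorem trace_palindromic_reverse (K : Type*) [Field K] (w : FreeGroup (Fin 2))
    (A B : Matrix.GeneralLinearGroup (Fin 2) K) :
    Matrix.trace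
        ((FreeGroup.lift ![A, B] w : Matrix.GeneralLinearGroup (Fin 2) K) :
          Matrix (Fin 2) (Fin 2) K) =
      Matrix.trace
        ((FreeGroup.lift ![A, B] (palRev w) : Matrix.GeneralLinearGroup (Fin 2) K) :
          Matrix (Fin 2) (Fin 2) K) := by
  simpa using trace_eq_of_mem_reversalPairs
    (lift_mul_mem_reversalPairs A B w (one_mem_reversalPairs A.val B.val))
end

section
/- Let K be a field, let p, q be integers, and let A, B ∈ GL (Fin 2) K be conjugate matrices (IsConj A B in the group GL (Fin 2) K). Then the trace of A^p * B^q equals the trace of A^q * B^p (powers taken as integer powers in the group GL (Fin 2) K). -/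
theorem Matrix.sq_fin_two {R : Type*} [CommRing R] (M : Matrix (Fin 2) (Fin 2) R) :
    M * M = M.trace • M - M.det • (1 : Matrix (Fin 2) (Fin 2) R) := by
  ext i j
  fin_cases i <;> fin_cases j <;>
    simp [Matrix.mul_apply, Fin.sum_univ_two, Matrix.trace_fin_two, Matrix.det_fin_two] <;> ring

/-- Every integer power of an invertible `2 × 2` matrix is a linear combination of the matrix
and the identity. -/
theorem Matrix.GeneralLinearGroup.exists_coe_zpow_eq_smul_add_smul_one {K : Type*} [Field K]
    (A : Matrix.GeneralLinearGroup (Fin 2) K) (n : ℤ) :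
    ∃ a b : K, ((A ^ n : Matrix.GeneralLinearGroup (Fin 2) K) : Matrix (Fin 2) (Fin 2) K) =
      a • (A : Matrix (Fin 2) (Fin 2) K) + b • (1 : Matrix (Fin 2) (Fin 2) K) := by
  have hsq := Matrix.sq_fin_two (A : Matrix (Fin 2) (Fin 2) K)
  have hdet : (A : Matrix (Fin 2) (Fin 2) K).det ≠ 0 := A.det_ne_zero
  set t := (A : Matrix (Fin 2) (Fin 2) K).trace
  set d := (A : Matrix (Fin 2) (Fin 2) K).det
  induction n using Int.induction_on with
  | zero => exact ⟨0, 1, by simp⟩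
  | succ n ih =>
    obtain ⟨a, b, hab⟩ := ih
    refine ⟨a * t + b, -(a * d), ?_⟩
    rw [_root_.zpow_add_one, Units.val_mul, hab, add_mul, smul_mul_assoc, smul_mul_assoc, hsq, one_mul]
    module
  | pred n ih =>
    obtain ⟨a, b, hab⟩ := ih
    refine ⟨-(b * d⁻¹), a + b * d⁻¹ * t, ?_⟩
    rw [_root_.zpow_sub_one, Units.val_mul, Units.mul_inv_eq_iff_eq_mul, hab, add_mul, smul_mul_assoc,
      smul_mul_assoc, hsq, one_mul]
    match_scalars <;> field_simp
    ring

/-- For any field `K`, integers `p, q`, and conjugate matrices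
`A, B ∈ GL(2, K)`, one has `tr (A^p B^q) = tr (A^q B^p)`. -/
theorem trace_powers_of_conjugate (K : Type*) [Field K] (p q : ℤ)
    (A B : Matrix.GeneralLinearGroup (Fin 2) K) (h : IsConj A B) :
    Matrix.trace
        ((A ^ p * B ^ q : Matrix.GeneralLinearGroup (Fin 2) K) :
          Matrix (Fin 2) (Fin 2) K) =
      Matrix.trace
        ((A ^ q * B ^ p : Matrix.GeneralLinearGroup (Fin 2) K) :
          Matrix (Fin 2) (Fin 2) K) := by
  obtain ⟨C, hC⟩ := isConj_iff.mp h
  have conj (n : ℤ) (a b : K)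
      (hA : ((A ^ n : Matrix.GeneralLinearGroup (Fin 2) K) : Matrix (Fin 2) (Fin 2) K) =
        a • (A : Matrix (Fin 2) (Fin 2) K) + b • (1 : Matrix (Fin 2) (Fin 2) K)) :
      ((B ^ n : Matrix.GeneralLinearGroup (Fin 2) K) : Matrix (Fin 2) (Fin 2) K) =
        a • (B : Matrix (Fin 2) (Fin 2) K) + b • (1 : Matrix (Fin 2) (Fin 2) K) := by
    rw [← hC, conj_zpow, Units.val_mul, Units.val_mul, hA, Units.val_mul, Units.val_mul,
      mul_add, add_mul, mul_smul_comm, mul_smul_comm, smul_mul_assoc, smul_mul_assoc, mul_one,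
      Units.mul_inv]
  have htrace : (B : Matrix (Fin 2) (Fin 2) K).trace = (A : Matrix (Fin 2) (Fin 2) K).trace := by
    rw [← hC, Units.val_mul, Units.val_mul, Matrix.trace_mul_comm, ← mul_assoc, Units.inv_mul,
      one_mul]
  obtain ⟨a, b, hp⟩ := A.exists_coe_zpow_eq_smul_add_smul_one p
  obtain ⟨c, d, hq⟩ := A.exists_coe_zpow_eq_smul_add_smul_one q
  rw [Units.val_mul, Units.val_mul, hp, hq, conj p a b hp, conj q c d hq]
  simp only [add_mul, mul_add, smul_mul_assoc, mul_smul_comm, mul_one, one_mul,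
    Matrix.trace_add, Matrix.trace_smul, htrace, smul_eq_mul]
  ring
end

section
/- Let k be a natural number and let u, v ∈ FreeGroup (Fin k) be character equivalent. Then for every w ∈ FreeGroup (Fin 2) and every group homomorphism ρ : FreeGroup (Fin k) →* Matrix.SpecialLinearGroup (Fin 2) ℂ, the trace of ρ (w(u,v)) equals the trace of ρ (w(v,u)); that is, w(u,v) and w(v,u) are character equivalent. -/
/-- Character (trace) equivalence: `u` and `v` have equal traces under every
representation into `SL(2, ℂ)`. -/
def CharEquiv {k : ℕ} (u v : FreeGroup (Fin k)) : Prop :=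
  ∀ ρ : FreeGroup (Fin k) →* Matrix.SpecialLinearGroup (Fin 2) ℂ,
    Matrix.trace ((ρ u : Matrix (Fin 2) (Fin 2) ℂ)) =
      Matrix.trace ((ρ v : Matrix (Fin 2) (Fin 2) ℂ))

theorem Matrix.trace_smul_one_sub_fin_two {R : Type*} [CommRing R] (A : Matrix (Fin 2) (Fin 2) R) :
    A.trace • (1 : Matrix (Fin 2) (Fin 2) R) - A = A.adjugate := by
  rw [adjugate_fin_two]
  ext i j
  fin_cases i <;> fin_cases j <;> simp [trace_fin_two]

namespace Matrix.SpecialLinearGroup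

variable {R : Type*} [CommRing R]

theorem coe_inv_eq_trace_smul_one_sub (A : SpecialLinearGroup (Fin 2) R) :
    ((A⁻¹ : SpecialLinearGroup (Fin 2) R) : Matrix (Fin 2) (Fin 2) R) =
      (A : Matrix (Fin 2) (Fin 2) R).trace • (1 : Matrix (Fin 2) (Fin 2) R) - A := by
  rw [coe_inv, trace_smul_one_sub_fin_two]

theorem coe_mul_self_eq (A : SpecialLinearGroup (Fin 2) R) :
    (A : Matrix (Fin 2) (Fin 2) R) * A =
      (A : Matrix (Fin 2) (Fin 2) R).trace • (A : Matrix (Fin 2) (Fin 2) R) - 1 := by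
  have h : (A : Matrix (Fin 2) (Fin 2) R) * (A⁻¹ : SpecialLinearGroup (Fin 2) R) = 1 := by
    rw [← coe_mul, mul_inv_cancel, coe_one]
  rw [coe_inv_eq_trace_smul_one_sub, mul_sub, mul_smul_comm, mul_one] at h
  rw [← h, sub_sub_cancel]

end Matrix.SpecialLinearGroup

theorem Matrix.mul_eq_of_trace_fin_two {R : Type*} [CommRing R]
    (A B : Matrix (Fin 2) (Fin 2) R) :
    B * A = B.trace • A + A.trace • B +
      ((A * B).trace - A.trace * B.trace) • (1 : Matrix (Fin 2) (Fin 2) R) - A * B := by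
  ext i j
  fin_cases i <;> fin_cases j <;> simp [trace_fin_two, mul_apply, Fin.sum_univ_two] <;> ring

section QuadraticRelations

variable {K S : Type*} [CommRing K] [Ring S] [Algebra K S]

theorem left_mul_mem_span_of_quadratic {X Y : S} {x : K} (hX : X * X = x • X - 1) {N : S}
    (hN : N ∈ Submodule.span K {1, X, Y, X * Y}) :
    X * N ∈ Submodule.span K {1, X, Y, X * Y} := by
  have h1 : (1 : S) ∈ Submodule.span K {1, X, Y, X * Y} := Submodule.subset_span (by simp)
  have h2 : X ∈ Submodule.span K {1, X, Y, X * Y} := Submodule.subset_span (by simp)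
  have h3 : Y ∈ Submodule.span K {1, X, Y, X * Y} := Submodule.subset_span (by simp)
  have h4 : X * Y ∈ Submodule.span K {1, X, Y, X * Y} := Submodule.subset_span (by simp)
  induction hN using Submodule.span_induction with
  | mem N hN =>
    obtain rfl | rfl | rfl | rfl := hN
    · rwa [mul_one]
    · rw [hX]
      exact sub_mem (Submodule.smul_mem _ _ h2) h1
    · exact h4
    · rw [← mul_assoc, hX, sub_mul, one_mul, smul_mul_assoc]
      exact sub_mem (Submodule.smul_mem _ _ h4) h3
  | zero => simp
  | add M N _ _ hM hN => rw [mul_add]; exact add_mem hM hN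
  | smul c N _ hN => rw [mul_smul_comm]; exact Submodule.smul_mem _ _ hN

theorem right_mul_mem_span_of_quadratic {X Y : S} {x y z : K} (hY : Y * Y = y • Y - 1)
    (hYX : Y * X = y • X + x • Y + z • (1 : S) - X * Y) {N : S}
    (hN : N ∈ Submodule.span K {1, X, Y, X * Y}) :
    Y * N ∈ Submodule.span K {1, X, Y, X * Y} := by
  have h1 : (1 : S) ∈ Submodule.span K {1, X, Y, X * Y} := Submodule.subset_span (by simp)
  have h2 : X ∈ Submodule.span K {1, X, Y, X * Y} := Submodule.subset_span (by simp)
  have h3 : Y ∈ Submodule.span K {1, X, Y, X * Y} := Submodule.subset_span (by simp)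
  have h4 : X * Y ∈ Submodule.span K {1, X, Y, X * Y} := Submodule.subset_span (by simp)
  have hYY : Y * Y ∈ Submodule.span K {1, X, Y, X * Y} := by
    rw [hY]
    exact sub_mem (Submodule.smul_mem _ _ h3) h1
  induction hN using Submodule.span_induction with
  | mem N hN =>
    obtain rfl | rfl | rfl | rfl := hN
    · rwa [mul_one]
    · rw [hYX]
      exact sub_mem (add_mem (add_mem (Submodule.smul_mem _ _ h2) (Submodule.smul_mem _ _ h3))
        (Submodule.smul_mem _ _ h1)) h4
    · exact hYY
    · have h : Y * (X * Y) = x • (Y * Y) + z • Y + X := by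
        rw [← mul_assoc, hYX, sub_mul, add_mul, add_mul, mul_assoc X Y Y, hY, mul_sub]
        simp only [smul_mul_assoc, mul_smul_comm, one_mul, mul_one, hY]
        abel
      rw [h]
      exact add_mem (add_mem (Submodule.smul_mem _ _ hYY) (Submodule.smul_mem _ _ h3)) h2
  | zero => simp
  | add M N _ _ hM hN => rw [mul_add]; exact add_mem hM hN
  | smul c N _ hN => rw [mul_smul_comm]; exact Submodule.smul_mem _ _ hN

end QuadraticRelations

open Matrix in
/-- If `A` and `B` in `SL(2, R)` have the same trace, then every word in `(A, B)` and `(B, A)` is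
simultaneously a combination of `1`, `(A, B)`, `(B, A)` and their product. -/
theorem Matrix.SpecialLinearGroup.lift_swap_mem_span {R : Type*} [CommRing R]
    (A B : SpecialLinearGroup (Fin 2) R)
    (h : (A : Matrix (Fin 2) (Fin 2) R).trace = (B : Matrix (Fin 2) (Fin 2) R).trace)
    (w : FreeGroup (Fin 2)) :
    ((FreeGroup.lift ![A, B] w : Matrix (Fin 2) (Fin 2) R),
        (FreeGroup.lift ![B, A] w : Matrix (Fin 2) (Fin 2) R)) ∈
      Submodule.span R {(1 : Matrix (Fin 2) (Fin 2) R × Matrix (Fin 2) (Fin 2) R),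
        ((A : Matrix (Fin 2) (Fin 2) R), (B : Matrix (Fin 2) (Fin 2) R)),
        ((B : Matrix (Fin 2) (Fin 2) R), (A : Matrix (Fin 2) (Fin 2) R)),
        ((A : Matrix (Fin 2) (Fin 2) R), (B : Matrix (Fin 2) (Fin 2) R)) *
          ((B : Matrix (Fin 2) (Fin 2) R), (A : Matrix (Fin 2) (Fin 2) R))} := by
  set X : Matrix (Fin 2) (Fin 2) R × Matrix (Fin 2) (Fin 2) R := (A, B) with hX_def
  set Y : Matrix (Fin 2) (Fin 2) R × Matrix (Fin 2) (Fin 2) R := (B, A) with hY_def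
  have hX : X * X = (A : Matrix (Fin 2) (Fin 2) R).trace • X - 1 :=
    Prod.ext (coe_mul_self_eq A) (by simpa [hX_def, h] using coe_mul_self_eq B)
  have hY : Y * Y = (A : Matrix (Fin 2) (Fin 2) R).trace • Y - 1 :=
    Prod.ext (by simpa [hY_def, h] using coe_mul_self_eq B) (coe_mul_self_eq A)
  have hYX : Y * X = (A : Matrix (Fin 2) (Fin 2) R).trace • X +
      (A : Matrix (Fin 2) (Fin 2) R).trace • Y +
      (((A : Matrix (Fin 2) (Fin 2) R) * B).trace - (A : Matrix (Fin 2) (Fin 2) R).trace *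
        (A : Matrix (Fin 2) (Fin 2) R).trace) • 1 - X * Y := by
    apply Prod.ext
    · simpa [hX_def, hY_def, h] using mul_eq_of_trace_fin_two (A : Matrix (Fin 2) (Fin 2) R) B
    · simpa [hX_def, hY_def, h, trace_mul_comm (B : Matrix (Fin 2) (Fin 2) R) A] using
        mul_eq_of_trace_fin_two (B : Matrix (Fin 2) (Fin 2) R) A
  have key : ∀ N ∈ Submodule.span R {1, X, Y, X * Y},
      ((FreeGroup.lift ![A, B] w : Matrix (Fin 2) (Fin 2) R),
        (FreeGroup.lift ![B, A] w : Matrix (Fin 2) (Fin 2) R)) * N ∈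
        Submodule.span R {1, X, Y, X * Y} := by
    induction w using FreeGroup.induction_on with
    | C1 => intro N hN; simpa [← Prod.one_eq_mk] using hN
    | of i =>
      intro N hN
      fin_cases i
      · simpa [hX_def] using left_mul_mem_span_of_quadratic hX hN
      · simpa [hY_def] using right_mul_mem_span_of_quadratic hY hYX hN
    | inv_of i hi =>
      intro N hN
      have hinv : ((FreeGroup.lift ![A, B] (FreeGroup.of i)⁻¹ : Matrix (Fin 2) (Fin 2) R),
          (FreeGroup.lift ![B, A] (FreeGroup.of i)⁻¹ : Matrix (Fin 2) (Fin 2) R)) =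
          (A : Matrix (Fin 2) (Fin 2) R).trace • 1 -
            ((FreeGroup.lift ![A, B] (FreeGroup.of i) : Matrix (Fin 2) (Fin 2) R),
              (FreeGroup.lift ![B, A] (FreeGroup.of i) : Matrix (Fin 2) (Fin 2) R)) := by
        rw [map_inv, map_inv, coe_inv_eq_trace_smul_one_sub, coe_inv_eq_trace_smul_one_sub]
        fin_cases i <;> ext1 <;> simp [h]
      rw [hinv, sub_mul, smul_mul_assoc, one_mul]
      exact sub_mem (Submodule.smul_mem _ _ hN) (hi N hN)
    | mul u v hu hv =>
      intro N hN
      rw [map_mul, map_mul, coe_mul, coe_mul, ← Prod.mk_mul_mk, mul_assoc]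
      exact hu _ (hv _ hN)
  simpa using key 1 (Submodule.subset_span (by simp))

/-- Words in two elements of `SL(2, R)` of equal trace keep their trace when the two elements are
swapped. -/
theorem Matrix.SpecialLinearGroup.trace_lift_swap {R : Type*} [CommRing R]
    (A B : SpecialLinearGroup (Fin 2) R)
    (h : (A : Matrix (Fin 2) (Fin 2) R).trace = (B : Matrix (Fin 2) (Fin 2) R).trace)
    (w : FreeGroup (Fin 2)) :
    (FreeGroup.lift ![A, B] w : Matrix (Fin 2) (Fin 2) R).trace =
      (FreeGroup.lift ![B, A] w : Matrix (Fin 2) (Fin 2) R).trace := by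
  have hle : Submodule.span R {(1 : Matrix (Fin 2) (Fin 2) R × Matrix (Fin 2) (Fin 2) R),
        ((A : Matrix (Fin 2) (Fin 2) R), (B : Matrix (Fin 2) (Fin 2) R)),
        ((B : Matrix (Fin 2) (Fin 2) R), (A : Matrix (Fin 2) (Fin 2) R)),
        ((A : Matrix (Fin 2) (Fin 2) R), (B : Matrix (Fin 2) (Fin 2) R)) *
          ((B : Matrix (Fin 2) (Fin 2) R), (A : Matrix (Fin 2) (Fin 2) R))} ≤
      LinearMap.eqLocus (traceLinearMap (Fin 2) R R ∘ₗ LinearMap.fst R _ _)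
        (traceLinearMap (Fin 2) R R ∘ₗ LinearMap.snd R _ _) := by
    rw [Submodule.span_le]
    rintro _ (rfl | rfl | rfl | rfl)
    · rfl
    · exact h
    · exact h.symm
    · exact Matrix.trace_mul_comm (A : Matrix (Fin 2) (Fin 2) R) B
  exact hle (lift_swap_mem_span A B h w)

/-- If `u` and `v` are character equivalent then so are `w(u,v)` and `w(v,u)` for
every two-variable word `w`. -/
theorem char_equiv_word_swap {k : ℕ} (u v : FreeGroup (Fin k)) (huv : CharEquiv u v)
    (w : FreeGroup (Fin 2))
    (ρ : FreeGroup (Fin k) →* Matrix.SpecialLinearGroup (Fin 2) ℂ) :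
    Matrix.trace ((ρ (FreeGroup.lift ![u, v] w) : Matrix (Fin 2) (Fin 2) ℂ)) =
      Matrix.trace ((ρ (FreeGroup.lift ![v, u] w) : Matrix (Fin 2) (Fin 2) ℂ)) := by
  have hlift (a b : FreeGroup (Fin k)) :
      ρ (FreeGroup.lift ![a, b] w) = FreeGroup.lift ![ρ a, ρ b] w := by
    rw [← MonoidHom.comp_apply]
    congr 1
    ext i : 1
    fin_cases i <;> simp
  rw [hlift, hlift]
  exact Matrix.SpecialLinearGroup.trace_lift_swap _ _ (huv ρ) w
end

section
/- Let A be a finite abelian group and let g ∈ A be an element of order greater than four. Then for every u ∈ A there exists an integer i such that the element g^i * u has order greater than four. -/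
/-- An element of order greater than four cannot translate an element of exponent three
through elements each of exponent three or four. -/
theorem pow_three_ne_one_of_forall_zpow_mul {A : Type*} [CommGroup A] {g u : A}
    (hg : 4 < orderOf g)
    (h : ∀ i : ℤ, (g ^ i * u) ^ 3 = 1 ∨ (g ^ i * u) ^ 4 = 1) : u ^ 3 ≠ 1 := by
  intro hu
  have hne : ∀ n, 0 < n → n ≤ 4 → g ^ n ≠ 1 := fun n h0 h4 =>
    pow_ne_one_of_lt_orderOf h0.ne' (h4.trans_lt hg)
  have h1 : (g * u) ^ 4 = 1 := by
    refine (zpow_one g ▸ h 1).resolve_left fun hc => hne 3 (by simp) (by simp) ?_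
    rwa [mul_pow, hu, mul_one] at hc
  have hm : (g⁻¹ * u) ^ 4 = 1 := by
    refine (zpow_neg_one g ▸ h (-1)).resolve_left fun hc => hne 3 (by simp) (by simp) ?_
    rwa [mul_pow, hu, mul_one, inv_pow, inv_eq_one] at hc
  have h8 : g ^ 8 = 1 := by
    calc g ^ 8 = (g * u) ^ 4 / (g⁻¹ * u) ^ 4 := by
          rw [← div_pow, mul_div_mul_right_eq_div, div_inv_eq_mul, ← sq, ← pow_mul]
      _ = 1 := by rw [h1, hm, div_one]
  have h2 : (g ^ 2 * u) ^ 3 = 1 := by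
    refine (zpow_ofNat g 2 ▸ h 2).resolve_right fun hc => hne 4 (by simp) le_rfl ?_
    have hc' : (g * (g * u)) ^ 4 = 1 := by
      rwa [← mul_assoc, ← sq]
    rwa [mul_pow, h1, mul_one] at hc'
  have h6 : g ^ 6 = 1 := by rwa [mul_pow, hu, mul_one, ← pow_mul] at h2
  refine hne 2 (by simp) (by simp) ?_
  rwa [show 8 = 6 + 2 from rfl, pow_add, h6, one_mul] at h8

/-- In a finite abelian group, if `g` has order greater than four then for every `u`
some `g^i * u` has order greater than four. -/
theorem exists_power_mul_orderOf_gt_four (A : Type*) [CommGroup A] [Finite A]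
    (g : A) (hg : 4 < orderOf g) (u : A) :
    ∃ i : ℤ, 4 < orderOf (g ^ i * u) := by
  by_contra! hcon
  have h : ∀ i : ℤ, (g ^ i * u) ^ 3 = 1 ∨ (g ^ i * u) ^ 4 = 1 := by
    intro i
    have hpos := orderOf_pos (g ^ i * u)
    have hle := hcon i
    rw [← orderOf_dvd_iff_pow_eq_one, ← orderOf_dvd_iff_pow_eq_one]
    interval_cases orderOf (g ^ i * u) <;> decide
  have h0 : u ^ 4 = 1 := by
    have h0 := h 0
    rw [zpow_zero, one_mul] at h0
    exact h0.resolve_left (pow_three_ne_one_of_forall_zpow_mul hg h)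
  have h1 : (g * u) ^ 4 = 1 := by
    refine (zpow_one g ▸ h 1).resolve_left (pow_three_ne_one_of_forall_zpow_mul hg fun i => ?_)
    rw [← mul_assoc, ← zpow_add_one]
    exact h (i + 1)
  rw [mul_pow, h0, mul_one] at h1
  exact pow_ne_one_of_lt_orderOf (by simp) hg h1
end

section
/- Let G be a nonabelian group whose abelianization contains an element of order greater than four (an element x with x^n ≠ 1 for n = 1, 2, 3, 4). Then there exists a noncentral element g ∈ G whose image in the abelianization has order greater than four: g ∉ Subgroup.center G and (Abelianization.of g)^n ≠ 1 for n = 1, 2, 3, 4. -/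
lemma pow_eq_one_of_mul_pow_eq_one {A : Type*} [CommGroup A] {a x : A} {n : ℕ} (k d : ℕ)
    (h : (a * x ^ k) ^ n = 1) (h' : (a * x ^ (k + d)) ^ n = 1) : x ^ (d * n) = 1 := by
  rwa [pow_add, ← mul_assoc, mul_pow, h, one_mul, ← pow_mul] at h'

/-- If no power `x ^ n` with `1 ≤ n ≤ 4` is trivial, then every coset of the powers of `x`
contains an element with the same property. -/
lemma exists_mul_pow_forall_pow_ne_one {A : Type*} [CommGroup A] (a : A) {x : A}
    (hx : ∀ n : ℕ, 1 ≤ n → n ≤ 4 → x ^ n ≠ 1) :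
    ∃ k : ℕ, ∀ n : ℕ, 1 ≤ n → n ≤ 4 → (a * x ^ k) ^ n ≠ 1 := by
  by_contra! H
  have three_or_four (k : ℕ) : (a * x ^ k) ^ 3 = 1 ∨ (a * x ^ k) ^ 4 = 1 := by
    obtain ⟨n, h1, h4, hn⟩ := H k
    have key {m : ℕ} (hm : n ∣ m) : (a * x ^ k) ^ m = 1 :=
      orderOf_dvd_iff_pow_eq_one.mp ((orderOf_dvd_of_pow_eq_one hn).trans hm)
    interval_cases n
    · exact .inl (key (by decide))
    · exact .inr (key (by decide))
    · exact .inl hn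
    · exact .inr hn
  have three_succ (k : ℕ) (h : (a * x ^ k) ^ 3 = 1) : (a * x ^ (k + 1)) ^ 4 = 1 :=
    (three_or_four (k + 1)).resolve_left fun h' ↦
      hx 3 (by decide) (by decide) (pow_eq_one_of_mul_pow_eq_one k 1 h h')
  have four_succ (k : ℕ) (h : (a * x ^ k) ^ 4 = 1) : (a * x ^ (k + 1)) ^ 3 = 1 :=
    (three_or_four (k + 1)).resolve_right fun h' ↦
      hx 4 (by decide) (by decide) (pow_eq_one_of_mul_pow_eq_one k 1 h h')
  obtain ⟨k, hk⟩ : ∃ k, (a * x ^ k) ^ 3 = 1 :=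
    (three_or_four 0).elim (fun h ↦ ⟨0, h⟩) fun h ↦ ⟨1, four_succ 0 h⟩
  have h1 := three_succ k hk
  have h2 := four_succ _ h1
  have h6 : x ^ 6 = 1 := pow_eq_one_of_mul_pow_eq_one k 2 hk h2
  have h8 : x ^ 8 = 1 := pow_eq_one_of_mul_pow_eq_one (k + 1) 2 h1 (three_succ _ h2)
  refine hx 2 (by decide) (by decide) ?_
  rwa [show 8 = 6 + 2 from rfl, pow_add, h6, one_mul] at h8

/-- A nonabelian group whose abelianization contains an element of order greater than
four contains a noncentral element whose image in the abelianization has order greater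
than four. -/
theorem exists_noncentral_order_gt_four_in_abelianization (G : Type*) [Group G]
    (hna : ¬ ∀ a b : G, a * b = b * a)
    (hx : ∃ x : Abelianization G, ∀ n : ℕ, 1 ≤ n → n ≤ 4 → x ^ n ≠ 1) :
    ∃ g : G, g ∉ Subgroup.center G ∧
      ∀ n : ℕ, 1 ≤ n → n ≤ 4 → (Abelianization.of g) ^ n ≠ 1 := by
  obtain ⟨x, hx⟩ := hx
  obtain ⟨g, rfl⟩ : ∃ g : G, Abelianization.of g = x := QuotientGroup.mk_surjective x
  by_cases hg : g ∈ Subgroup.center G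
  · obtain ⟨c, hc⟩ : ∃ c : G, c ∉ Subgroup.center G := by
      by_contra! H
      exact hna fun a b ↦ Subgroup.mem_center_iff.mp (H b) a
    obtain ⟨k, hk⟩ := exists_mul_pow_forall_pow_ne_one (Abelianization.of c) hx
    refine ⟨c * g ^ k, ?_, by simpa only [map_mul, map_pow] using hk⟩
    rwa [Subgroup.mul_mem_cancel_right _ (Subgroup.pow_mem _ hg k)]
  · exact ⟨g, hg, hx⟩
end

section
/- Let A, B ∈ GL(2,ℝ)⁺ be conjugate elements (IsConj A B) and let p, q be integers. Then the hyperbolic translation lengths of A^p * B^q and of A^q * B^p on the upper half-plane are equal: ⨅ z : ℍ, dist z ((A^p * B^q) • z) = ⨅ z : ℍ, dist z ((A^q * B^p) • z). -/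
open scoped MatrixGroups UpperHalfPlane

set_option synthInstance.maxHeartbeats 1000000

/-- The displacement of a Möbius transformation, in terms of the trace and determinant and of the
quantity `c * |z| ^ 2 + (d - a) * re z - b`. -/
lemma UpperHalfPlane.cosh_dist_glPos_smul (g : Matrix.GLPos (Fin 2) ℝ) (z : ℍ) :
    Real.cosh (dist z (g • z)) =
      1 + (((g.1.1 1 0 * (z.re ^ 2 + z.im ^ 2) + (g.1.1 1 1 - g.1.1 0 0) * z.re - g.1.1 0 1)
          / z.im) ^ 2 + (g.1.1.trace ^ 2 - 4 * g.1.1.det)) / (2 * g.1.1.det) := by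
  have hD : 0 < g.1.1.det := g.2
  have hD' : 0 < g.1.det.val := g.2
  have hz := z.im_pos
  have hden := UpperHalfPlane.normSq_denom_ne_zero g.1 z.im_ne_zero
  have hden' := UpperHalfPlane.denom_ne_zero g.1 z
  have him : (g • z).im = g.1.1.det * z.im / Complex.normSq (denom g.1 z) := by
    change (g.1 • z).im = _
    rw [UpperHalfPlane.im_smul_eq_div_normSq, abs_of_pos hD']
    rfl
  have hcoe : ((g • z : ℍ) : ℂ) = num g.1 z / denom g.1 z :=
    UpperHalfPlane.coe_smul_of_det_pos hD' z
  have hdist : dist (z : ℂ) (g • z : ℍ) ^ 2 =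
      Complex.normSq (z * denom g.1 z - num g.1 z) / Complex.normSq (denom g.1 z) := by
    rw [dist_eq_norm, ← Complex.normSq_eq_norm_sq, ← Complex.normSq_div, hcoe]
    congr 1
    field_simp
  have hnum : Complex.normSq (z * denom g.1 z - num g.1 z) =
      (g.1.1 1 0 * (z.re ^ 2 + z.im ^ 2) + (g.1.1 1 1 - g.1.1 0 0) * z.re - g.1.1 0 1) ^ 2
        + z.im ^ 2 * (g.1.1.trace ^ 2 - 4 * g.1.1.det) := by
    rw [Matrix.trace_fin_two, Matrix.det_fin_two]
    simp [Complex.normSq_apply, num, denom]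
    ring
  rw [UpperHalfPlane.cosh_dist, hdist, hnum, him]
  field_simp

lemma UpperHalfPlane.le_cosh_dist_glPos_smul (g : Matrix.GLPos (Fin 2) ℝ) (z : ℍ) :
    1 + max (g.1.1.trace ^ 2 - 4 * g.1.1.det) 0 / (2 * g.1.1.det) ≤
      Real.cosh (dist z (g • z)) := by
  have hD : 0 < g.1.1.det := g.2
  rcases max_cases (g.1.1.trace ^ 2 - 4 * g.1.1.det) 0 with ⟨h, -⟩ | ⟨h, -⟩
  · rw [h, cosh_dist_glPos_smul]
    gcongr
    exact le_add_of_nonneg_left (sq_nonneg _)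
  · simp [h]

lemma UpperHalfPlane.exists_sq_displacement_lt (a b c d : ℝ) {ε : ℝ} (hε : 0 < ε) :
    ∃ z : ℍ, ((c * (z.re ^ 2 + z.im ^ 2) + (d - a) * z.re - b) / z.im) ^ 2
      + ((a - d) ^ 2 + 4 * b * c) < max ((a - d) ^ 2 + 4 * b * c) 0 + ε := by
  set Δ := (a - d) ^ 2 + 4 * b * c with hΔ
  rcases eq_or_ne c 0 with rfl | hc
  · have hΔ0 : 0 ≤ Δ := by rw [hΔ]; simpa using sq_nonneg (a - d)
    rw [max_eq_left hΔ0]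
    rcases eq_or_ne d a with rfl | hda
    · obtain ⟨y, hy, hlt⟩ : ∃ y : ℝ, 0 < y ∧ (b / y) ^ 2 < ε := by
        refine ⟨(|b| + 1) / √ε, by positivity, ?_⟩
        rw [div_div_eq_mul_div, div_pow, mul_pow, Real.sq_sqrt hε.le, div_lt_iff₀ (by positivity)]
        nlinarith [sq_abs b, abs_nonneg b]
      refine ⟨⟨⟨0, y⟩, hy⟩, ?_⟩
      simp only [UpperHalfPlane.re, UpperHalfPlane.im]
      have : (0 * (0 ^ 2 + y ^ 2) + (d - d) * 0 - b) / y = -(b / y) := by ring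
      rw [this, neg_sq]
      linarith
    · have hda' : d - a ≠ 0 := sub_ne_zero.mpr hda
      refine ⟨⟨⟨b / (d - a), 1⟩, one_pos⟩, ?_⟩
      simp only [UpperHalfPlane.re, UpperHalfPlane.im]
      have : (0 * ((b / (d - a)) ^ 2 + 1 ^ 2) + (d - a) * (b / (d - a)) - b) / 1 = 0 := by
        field_simp
        ring
      rw [this]
      linarith
  · have key (y : ℝ) : c * (((a - d) / (2 * c)) ^ 2 + y ^ 2) + (d - a) * ((a - d) / (2 * c)) - b
        = c * y ^ 2 - Δ / (4 * c) := by
      rw [hΔ]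
      field_simp
      ring
    suffices ∃ y : ℝ, 0 < y ∧ ((c * y ^ 2 - Δ / (4 * c)) / y) ^ 2 + Δ < max Δ 0 + ε by
      obtain ⟨y, hy, h⟩ := this
      refine ⟨⟨⟨(a - d) / (2 * c), y⟩, hy⟩, ?_⟩
      simp only [UpperHalfPlane.re, UpperHalfPlane.im]
      rwa [key]
    have hc2 : 0 < c ^ 2 := by positivity
    rcases lt_trichotomy Δ 0 with h | h | h
    · have hy2 : 0 < -Δ / (4 * c ^ 2) := div_pos (by linarith) (by positivity)
      refine ⟨√(-Δ / (4 * c ^ 2)), Real.sqrt_pos.mpr hy2, ?_⟩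
      have h0 : (c * (-Δ / (4 * c ^ 2)) - Δ / (4 * c)) ^ 2 / (-Δ / (4 * c ^ 2)) = -Δ := by
        have := h.ne
        field_simp
        ring
      rw [max_eq_right h.le, div_pow, Real.sq_sqrt hy2.le, h0]
      linarith
    · refine ⟨√ε / (2 * |c|), by positivity, ?_⟩
      have h0 : (c * (√ε / (2 * |c|)) ^ 2 - 0 / (4 * c)) / (√ε / (2 * |c|))
          = c * (√ε / (2 * |c|)) := by
        field_simp
        ring
      rw [h, h0, mul_pow, div_pow, mul_pow, sq_abs, Real.sq_sqrt hε.le]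
      have : c ^ 2 * (ε / (2 ^ 2 * c ^ 2)) = ε / 4 := by
        field_simp
        norm_num
      rw [this, max_self]
      linarith
    · have hy2 : 0 < Δ / (4 * c ^ 2) := by positivity
      refine ⟨√(Δ / (4 * c ^ 2)), Real.sqrt_pos.mpr hy2, ?_⟩
      have h0 : c * (Δ / (4 * c ^ 2)) - Δ / (4 * c) = 0 := by
        field_simp
        ring
      rw [max_eq_left h.le, Real.sq_sqrt hy2.le, h0]
      simpa using hε

lemma UpperHalfPlane.exists_cosh_dist_glPos_smul_lt (g : Matrix.GLPos (Fin 2) ℝ) {r : ℝ}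
    (hr : 1 + max (g.1.1.trace ^ 2 - 4 * g.1.1.det) 0 / (2 * g.1.1.det) < r) :
    ∃ z : ℍ, Real.cosh (dist z (g • z)) < r := by
  have hD : 0 < g.1.1.det := g.2
  have hdisc : g.1.1.trace ^ 2 - 4 * g.1.1.det =
      (g.1.1 0 0 - g.1.1 1 1) ^ 2 + 4 * g.1.1 0 1 * g.1.1 1 0 := by
    rw [Matrix.trace_fin_two, Matrix.det_fin_two]
    ring
  have hε : 0 < (r - 1) * (2 * g.1.1.det) - max (g.1.1.trace ^ 2 - 4 * g.1.1.det) 0 := by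
    rw [← lt_sub_iff_add_lt', div_lt_iff₀ (by positivity)] at hr
    linarith
  obtain ⟨z, hz⟩ := exists_sq_displacement_lt (g.1.1 0 0) (g.1.1 0 1) (g.1.1 1 0) (g.1.1 1 1) hε
  refine ⟨z, ?_⟩
  rw [← hdisc, add_sub_cancel] at hz
  rw [cosh_dist_glPos_smul, ← lt_sub_iff_add_lt', div_lt_iff₀ (by positivity)]
  exact hz

lemma UpperHalfPlane.iInf_dist_smul_le_of_trace_eq_of_det_eq {g h : Matrix.GLPos (Fin 2) ℝ}
    (htr : g.1.1.trace = h.1.1.trace) (hdet : g.1.1.det = h.1.1.det) :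
    (⨅ z : ℍ, dist z (g • z)) ≤ ⨅ z : ℍ, dist z (h • z) := by
  refine le_ciInf fun z => le_of_forall_gt fun s hs => ?_
  have hs0 : 0 ≤ s := dist_nonneg.trans hs.le
  have hlt : Real.cosh (dist z (h • z)) < Real.cosh s := by
    rwa [Real.cosh_lt_cosh, abs_of_nonneg dist_nonneg, abs_of_nonneg hs0]
  have hle := le_cosh_dist_glPos_smul h z
  rw [← htr, ← hdet] at hle
  obtain ⟨w, hw⟩ := exists_cosh_dist_glPos_smul_lt g (hle.trans_lt hlt)
  rw [Real.cosh_lt_cosh, abs_of_nonneg dist_nonneg, abs_of_nonneg hs0] at hw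
  exact (ciInf_le ⟨0, by rintro _ ⟨x, rfl⟩; exact dist_nonneg⟩ w).trans_lt hw

/-- The translation length depends only on the trace and the determinant. -/
lemma UpperHalfPlane.iInf_dist_smul_eq_of_trace_eq_of_det_eq {g h : Matrix.GLPos (Fin 2) ℝ}
    (htr : g.1.1.trace = h.1.1.trace) (hdet : g.1.1.det = h.1.1.det) :
    (⨅ z : ℍ, dist z (g • z)) = ⨅ z : ℍ, dist z (h • z) :=
  (iInf_dist_smul_le_of_trace_eq_of_det_eq htr hdet).antisymm
    (iInf_dist_smul_le_of_trace_eq_of_det_eq htr.symm hdet.symm)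

lemma Matrix.GeneralLinearGroup.exists_zpow_eq_smul_add_smul_one {K : Type*} [Field K]
    (A : GL (Fin 2) K) (n : ℤ) :
    ∃ u v : K, ((A ^ n : GL (Fin 2) K) : Matrix (Fin 2) (Fin 2) K) = u • A.1 + v • 1 := by
  have hD : A.1.det ≠ 0 := A.det.ne_zero
  have hsq : A.1 * A.1 = A.1.trace • A.1 - A.1.det • 1 := by
    ext i j
    fin_cases i <;> fin_cases j <;>
      simp [Matrix.mul_apply, Fin.sum_univ_two, Matrix.trace_fin_two, Matrix.det_fin_two] <;> ring
  have hinv : (A⁻¹).1 = (-A.1.det⁻¹) • A.1 + (A.1.det⁻¹ * A.1.trace) • 1 := by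
    rw [Matrix.coe_units_inv]
    refine Matrix.inv_eq_right_inv ?_
    rw [mul_add, mul_smul_comm, mul_smul_comm, hsq, mul_one, smul_sub, smul_smul, smul_smul,
      neg_mul, neg_mul, inv_mul_cancel₀ hD]
    module
  induction n with
  | zero => exact ⟨0, 1, by simp⟩
  | succ n ih =>
    obtain ⟨u, v, h⟩ := ih
    refine ⟨u * A.1.trace + v, -(u * A.1.det), ?_⟩
    rw [_root_.zpow_add_one, Units.val_mul, h, add_mul, smul_mul_assoc, smul_mul_assoc, hsq, one_mul]
    module
  | pred n ih =>
    obtain ⟨u, v, h⟩ := ih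
    refine ⟨-(v * A.1.det⁻¹), u + v * (A.1.det⁻¹ * A.1.trace), ?_⟩
    rw [_root_.zpow_sub_one, Units.val_mul, h, add_mul, smul_mul_assoc, smul_mul_assoc, one_mul,
      ← Units.val_mul, mul_inv_cancel, hinv, Units.val_one]
    module

lemma Matrix.GeneralLinearGroup.trace_zpow_mul_zpow_comm_of_isConj {K : Type*} [Field K]
    {A B : GL (Fin 2) K} (h : IsConj A B) (p q : ℤ) :
    (A ^ p * B ^ q).1.trace = (A ^ q * B ^ p).1.trace := by
  obtain ⟨C, rfl⟩ := isConj_iff.mp h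
  obtain ⟨u, v, hp⟩ := exists_zpow_eq_smul_add_smul_one A p
  obtain ⟨s, t, hq⟩ := exists_zpow_eq_smul_add_smul_one A q
  have hC : C.1 * C⁻¹.1 = 1 := C.mul_inv
  have htr : (C.1 * A.1 * C⁻¹.1).trace = A.1.trace := by
    rw [Matrix.trace_mul_cycle, C.inv_mul, one_mul]
  simp only [conj_zpow, Units.val_mul, hp, hq, mul_add, add_mul, mul_smul_comm, smul_mul_assoc,
    mul_one, one_mul, hC, Matrix.trace_add, Matrix.trace_smul, smul_eq_mul, htr]
  ring

/-- For conjugate `A, B ∈ GL(2,ℝ)⁺` and integers `p, q`, the hyperbolic translation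
lengths of `A^p * B^q` and `A^q * B^p` on the upper half-plane are equal. -/
theorem translation_length_power_redistribution
    (A B : Matrix.GLPos (Fin 2) ℝ) (h : IsConj A B) (p q : ℤ) :
    (⨅ z : ℍ, dist z ((A ^ p * B ^ q) • z)) =
      ⨅ z : ℍ, dist z ((A ^ q * B ^ p) • z) := by
  have h' : IsConj A.1 B.1 := (Matrix.GLPos (Fin 2) ℝ).subtype.map_isConj h
  refine UpperHalfPlane.iInf_dist_smul_eq_of_trace_eq_of_det_eq
    (Matrix.GeneralLinearGroup.trace_zpow_mul_zpow_comm_of_isConj h' p q) ?_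
  have hdet : Matrix.GeneralLinearGroup.det A.1 = Matrix.GeneralLinearGroup.det B.1 :=
    isConj_iff_eq.mp (Matrix.GeneralLinearGroup.det.map_isConj h')
  have : Matrix.GeneralLinearGroup.det (A.1 ^ p * B.1 ^ q) =
      Matrix.GeneralLinearGroup.det (A.1 ^ q * B.1 ^ p) := by
    simp only [map_mul, map_zpow, hdet, ← zpow_add, add_comm]
  exact congrArg Units.val this
end

section
/- Let k ≥ 2, let g be a nontrivial element of FreeGroup (Fin k), let ℓ be a cyclically reduced representative of g, and let x, y be letters with distinct underlying generators. Then, as integers, ‖φ_{x,y}(g)‖ − ‖g‖ = n(ℓ; x) − 2 · n(ℓ; x, y⁻¹), where n(ℓ; x) denotes n(ℓ; a) for a the generator underlying x. -/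
/-- The cyclically reduced length of an element of a free group: the minimal
reduced word length among its conjugates. -/
noncomputable def cyclLen {α : Type*} [DecidableEq α] (g : FreeGroup α) : ℕ :=
  sInf {n : ℕ | ∃ x : FreeGroup α, FreeGroup.norm (x * g * x⁻¹) = n}

/-- `ℓ` is a cyclically reduced representative of `g`. -/
def IsCyclRep {k : ℕ} (g : FreeGroup (Fin k)) (ℓ : List (Fin k × Bool)) : Prop :=
  FreeGroup.reduce ℓ = ℓ ∧ IsConj (FreeGroup.mk ℓ) g ∧ ℓ.length = cyclLen g

/-- `n(ℓ; a)`: the total number of occurrences of the letters `a` and `a⁻¹` in `ℓ`. -/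
def nLetter {k : ℕ} (ℓ : List (Fin k × Bool)) (a : Fin k) : ℕ :=
  (ℓ.filter (fun p => decide (p.1 = a))).length

/-- The inverse of a letter `(a, ε)` is `(a, !ε)`. -/
def letterInv {k : ℕ} (x : Fin k × Bool) : Fin k × Bool := (x.1, !x.2)

/-- The element of the free group represented by a single letter. -/
def letterElt {k : ℕ} (x : Fin k × Bool) : FreeGroup (Fin k) :=
  if x.2 then FreeGroup.of x.1 else (FreeGroup.of x.1)⁻¹

/-- `n(ℓ; x, y)`: the number of cyclic positions of the cyclic word `ℓ` where the
cyclically consecutive pair of letters equals `(x, y)` or `(y⁻¹, x⁻¹)`. -/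
def nPair {k : ℕ} (ℓ : List (Fin k × Bool)) (x y : Fin k × Bool) : ℕ :=
  (Finset.univ.filter (fun i : Fin ℓ.length =>
    ((ℓ.get i = x ∧
        ℓ.get ⟨(i.1 + 1) % ℓ.length,
          Nat.mod_lt _ (Nat.lt_of_le_of_lt (Nat.zero_le _) i.isLt)⟩ = y) ∨
     (ℓ.get i = letterInv y ∧
        ℓ.get ⟨(i.1 + 1) % ℓ.length,
          Nat.mod_lt _ (Nat.lt_of_le_of_lt (Nat.zero_le _) i.isLt)⟩ = letterInv x)))).card

open FreeGroup

section Letters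

variable {k : ℕ}

theorem letterInv_letterInv (a : Fin k × Bool) : letterInv (letterInv a) = a := by
  simp [letterInv]

theorem letterInv_injective : Function.Injective (letterInv (k := k)) :=
  Function.LeftInverse.injective letterInv_letterInv

theorem letterInv_fst (a : Fin k × Bool) : (letterInv a).1 = a.1 := rfl

theorem letterInv_ne (a : Fin k × Bool) : letterInv a ≠ a := by
  simp [letterInv, Prod.ext_iff]

theorem eq_or_eq_letterInv {a x : Fin k × Bool} (h : a.1 = x.1) : a = x ∨ a = letterInv x := by
  rcases a with ⟨a, b⟩
  rcases x with ⟨x, c⟩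
  cases b <;> cases c <;> simp_all [letterInv]

theorem mk_singleton_eq_letterElt (a : Fin k × Bool) : mk [a] = letterElt a := by
  rcases a with ⟨a, _ | _⟩ <;> simp [letterElt, of, inv_mk, invRev]

theorem mk_letterInv (a : Fin k × Bool) : mk [letterInv a] = (mk [a])⁻¹ := by
  simp [letterInv, inv_mk, invRev]

theorem mk_cons (a : Fin k × Bool) (w : List (Fin k × Bool)) : mk (a :: w) = mk [a] * mk w := by
  simp [mul_mk]

theorem isReduced_cons_iff (a : Fin k × Bool) (w : List (Fin k × Bool)) :
    IsReduced (a :: w) ↔ w.head? ≠ some (letterInv a) ∧ IsReduced w := by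
  cases w with
  | nil => simp
  | cons b w =>
    rw [isReduced_cons_cons]
    rcases a with ⟨a, _ | _⟩ <;> rcases b with ⟨b, _ | _⟩ <;> simp [letterInv, eq_comm]

end Letters

/-- The number of consecutive pairs `(x, y)` or `(y⁻¹, x⁻¹)` in the word `w`, where `c` is the
letter (if any) that follows the last letter of `w`. -/
def pairCount {k : ℕ} (x y : Fin k × Bool) (c : Option (Fin k × Bool)) :
    List (Fin k × Bool) → ℕ
  | [] => 0
  | a :: w => (if (a = x ∧ w.head?.or c = some y) ∨
      (a = letterInv y ∧ w.head?.or c = some (letterInv x)) then 1 else 0) + pairCount x y c w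

section PairCount

variable {k : ℕ} (x y : Fin k × Bool)

theorem pairCount_le_pairCount_none (c : Option (Fin k × Bool)) (w : List (Fin k × Bool)) :
    pairCount x y none w ≤ pairCount x y c w ∧
      pairCount x y c w ≤ pairCount x y none w + 1 := by
  induction w with
  | nil => simp [pairCount]
  | cons a w ih =>
    cases w with
    | nil =>
      simp only [pairCount]
      split_ifs <;> simp_all
    | cons b w =>
      have h (c : Option (Fin k × Bool)) : pairCount x y c (a :: b :: w) =
          (if (a = x ∧ b = y) ∨ (a = letterInv y ∧ b = letterInv x) then 1 else 0) +
            pairCount x y c (b :: w) := by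
        simp only [pairCount, List.head?_cons, Option.some_or, Option.some.injEq]
      rw [h, h]
      omega

theorem pairCount_append (c : Option (Fin k × Bool)) (u v : List (Fin k × Bool)) :
    pairCount x y c (u ++ v) = pairCount x y (v.head?.or c) u + pairCount x y c v := by
  induction u with
  | nil => simp [pairCount]
  | cons a u ih =>
    simp only [List.cons_append, pairCount, ih, List.head?_append, Option.or_assoc, add_assoc]

theorem pairCount_flatten_replicate (w : List (Fin k × Bool)) (n : ℕ) :
    pairCount x y w.head? (List.replicate n w).flatten = n * pairCount x y w.head? w := by
  induction n with
  | zero => simp [pairCount]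
  | succ n ih =>
    have h : (List.replicate n w).flatten.head?.or w.head? = w.head? := by
      cases n <;> cases w <;> simp [List.replicate_succ]
    rw [List.replicate_succ, List.flatten_cons, pairCount_append, h, ih]
    ring

theorem pairCount_eq_sum (c : Option (Fin k × Bool)) (w : List (Fin k × Bool)) :
    pairCount x y c w = ∑ i : Fin w.length,
      if (w.get i = x ∧ (w[i.1 + 1]?).or c = some y) ∨
        (w.get i = letterInv y ∧ (w[i.1 + 1]?).or c = some (letterInv x)) then 1 else 0 := by
  induction w with
  | nil => simp [pairCount]
  | cons a w ih =>
    rw [pairCount, ih]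
    simp only [List.length_cons]
    rw [Fin.sum_univ_succ]
    simp [List.head?_eq_getElem?]

theorem nPair_eq_pairCount (w : List (Fin k × Bool)) :
    nPair w x y = pairCount x y w.head? w := by
  rw [pairCount_eq_sum, nPair, Finset.card_filter]
  refine Finset.sum_congr rfl fun i _ => ?_
  have h : ∀ hi, (w[i.1 + 1]?).or w.head? = some (w.get ⟨(i.1 + 1) % w.length, hi⟩) := by
    intro hi
    rcases Nat.lt_or_ge (i.1 + 1) w.length with h | h
    · simp [h, Nat.mod_eq_of_lt h]
    · have h' : i.1 + 1 = w.length := by omega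
      simp [h', List.head?_eq_getElem?,
        List.getElem?_eq_getElem (Nat.lt_of_le_of_lt (Nat.zero_le _) i.isLt)]
  simp only [h (Nat.mod_lt _ (Nat.lt_of_le_of_lt (Nat.zero_le _) i.isLt)), Option.some.injEq]

end PairCount

theorem nLetter_flatten_replicate {k : ℕ} (w : List (Fin k × Bool)) (a : Fin k) (n : ℕ) :
    nLetter (List.replicate n w).flatten a = n * nLetter w a := by
  simp [nLetter, List.filter_flatten, List.map_replicate]

section Nielsen

variable {k : ℕ} {x y : Fin k × Bool} {φ : FreeGroup (Fin k) ≃* FreeGroup (Fin k)}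

theorem map_mk_singleton_of_fst_ne
    (hφ : ∀ a : Fin k, a ≠ x.1 → φ (FreeGroup.of a) = FreeGroup.of a)
    {a : Fin k × Bool} (ha : a.1 ≠ x.1) : φ (mk [a]) = mk [a] := by
  rw [mk_singleton_eq_letterElt, letterElt]
  split_ifs <;> simp [hφ a.1 ha]

/-- The reduced form of the image of a reduced word under the Nielsen automorphism, together with
its length and its first letters. -/
theorem exists_reduced_image (hxy : x.1 ≠ y.1)
    (hφx : φ (letterElt x) = letterElt x * letterElt y)
    (hφ : ∀ a : Fin k, a ≠ x.1 → φ (FreeGroup.of a) = FreeGroup.of a)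
    (w : List (Fin k × Bool)) (hw : IsReduced w) :
    ∃ t, IsReduced t ∧ mk t = φ (mk w) ∧
      t.length + 2 * pairCount x (letterInv y) none w = w.length + nLetter w x.1 ∧
      (w.head? = some (letterInv x) → ∃ s, t = letterInv y :: letterInv x :: s) ∧
      (w.head? = some (letterInv y) →
        ∃ s, t = letterInv y :: s ∧ s.head? ≠ some (letterInv x)) ∧
      ∀ c, t.head? = some c → w.head? = some c ∨
        (w.head? = some (letterInv x) ∧ c = letterInv y) ∨
        (w.head? = some y ∧ c = letterInv x) := by
  simp only [← mk_singleton_eq_letterElt] at hφx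
  have hx'y' : letterInv x ≠ letterInv y :=
    fun h => hxy (by simpa [letterInv_fst] using congrArg Prod.fst h)
  have hx'y : letterInv x ≠ y :=
    fun h => hxy (by simpa [letterInv_fst] using congrArg Prod.fst h)
  have hxy' : x ≠ letterInv y :=
    fun h => hxy (by simpa [letterInv_fst] using congrArg Prod.fst h)
  have hne : x ≠ y := fun h => hxy (congrArg Prod.fst h)
  have hx := letterInv_ne x
  have hy := letterInv_ne y
  induction w with
  | nil => exact ⟨[], by simp [pairCount, nLetter, ← one_eq_mk]⟩
  | cons a w ih =>
    rw [isReduced_cons_iff] at hw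
    obtain ⟨hwa, hw⟩ := hw
    obtain ⟨t, ht, htw, hlen, hX, hY, hc⟩ := ih hw
    rw [mk_cons, _root_.map_mul, ← htw]
    by_cases hax : a = x
    · subst hax
      by_cases hwy : w.head? = some (letterInv y)
      · obtain ⟨s, rfl, hs⟩ := hY hwy
        refine ⟨a :: s, ?_, ?_, ?_, ?_, ?_, ?_⟩
        · exact (isReduced_cons_iff _ _).2 ⟨hs, ((isReduced_cons_iff _ _).1 ht).2⟩
        · rw [hφx, mk_cons, mk_cons (letterInv y), mk_letterInv]
          group
        · simp [pairCount, nLetter, hwy] at hlen ⊢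
          omega
        all_goals simp_all [eq_comm]
      · refine ⟨a :: y :: t, ?_, ?_, ?_, ?_, ?_, ?_⟩
        · rw [isReduced_cons_iff, isReduced_cons_iff]
          refine ⟨by simpa using hx'y.symm, fun h => ?_, ht⟩
          have := hc _ h
          simp_all
        · rw [hφx, mk_cons, mk_cons y, mul_assoc]
        · simp [pairCount, nLetter, hwy, letterInv_letterInv, hne] at hlen ⊢
          omega
        all_goals simp_all [eq_comm]
    by_cases hax' : a = letterInv x
    · subst hax'
      refine ⟨letterInv y :: letterInv x :: t, ?_, ?_, ?_, ?_, ?_, ?_⟩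
      · rw [isReduced_cons_iff, isReduced_cons_iff]
        refine ⟨by simpa [letterInv_letterInv] using hx'y, fun h => ?_, ht⟩
        rw [letterInv_letterInv] at h hwa
        rcases hc _ h with h | ⟨-, h⟩ | ⟨-, h⟩
        exacts [hwa h, hxy' h, hx h.symm]
      · rw [mk_letterInv, _root_.map_inv, hφx, mk_cons, mk_cons (letterInv x), mk_letterInv,
          mk_letterInv]
        group
      · simp [pairCount, nLetter, letterInv_letterInv, letterInv_fst, hx, hx'y] at hlen ⊢
        omega
      all_goals simp_all [eq_comm]
    have ha : a.1 ≠ x.1 := fun h => (eq_or_eq_letterInv h).elim hax hax'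
    rw [map_mk_singleton_of_fst_ne hφ ha]
    by_cases hyx : a = y ∧ w.head? = some (letterInv x)
    · obtain ⟨rfl, hwx⟩ := hyx
      obtain ⟨s, rfl⟩ := hX hwx
      refine ⟨letterInv x :: s, ?_, ?_, ?_, ?_, ?_, ?_⟩
      · exact ((isReduced_cons_iff _ _).1 ht).2
      · rw [mk_cons (letterInv a), mk_letterInv]
        group
      · simp [pairCount, nLetter, hwx, letterInv_letterInv, ha] at hlen ⊢
        omega
      all_goals simp_all [eq_comm]
    · refine ⟨a :: t, ?_, (mk_cons _ _), ?_, ?_, ?_, ?_⟩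
      · rw [isReduced_cons_iff]
        refine ⟨fun h => ?_, ht⟩
        rcases hc _ h with h | ⟨h, h'⟩ | ⟨-, h'⟩
        exacts [hwa h, hyx ⟨letterInv_injective h', h⟩, hax (letterInv_injective h')]
      · simp [pairCount, nLetter, letterInv_letterInv, ha, hax, hyx] at hlen ⊢
        omega
      · simp_all
      · intro h
        obtain rfl : a = letterInv y := by simpa using h
        refine ⟨t, rfl, fun h => ?_⟩
        rcases hc _ h with hw' | ⟨-, h'⟩ | ⟨hw', -⟩
        · obtain ⟨s, rfl⟩ := hX hw'
          exact hx'y' (by simpa using h.symm)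
        · exact hx'y' h'
        · exact hwa (by rw [hw', letterInv_letterInv])
      · simp_all

theorem norm_map_mk_add (hxy : x.1 ≠ y.1)
    (hφx : φ (letterElt x) = letterElt x * letterElt y)
    (hφ : ∀ a : Fin k, a ≠ x.1 → φ (FreeGroup.of a) = FreeGroup.of a)
    {w : List (Fin k × Bool)} (hw : IsReduced w) :
    norm (φ (mk w)) + 2 * pairCount x (letterInv y) none w = w.length + nLetter w x.1 := by
  obtain ⟨t, ht, htw, hlen, -⟩ := exists_reduced_image hxy hφx hφ w hw
  rw [← hlen, ← htw, FreeGroup.norm, toWord_mk, ht.reduce_eq]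

end Nielsen

section CyclLen

variable {α : Type*} [DecidableEq α]

theorem cyclLen_le_norm_conj (g x : FreeGroup α) : cyclLen g ≤ norm (x * g * x⁻¹) :=
  Nat.sInf_le ⟨x, rfl⟩

theorem exists_norm_conj_eq_cyclLen (g : FreeGroup α) :
    ∃ x : FreeGroup α, norm (x * g * x⁻¹) = cyclLen g :=
  Nat.sInf_mem (s := {n : ℕ | ∃ x : FreeGroup α, norm (x * g * x⁻¹) = n}) ⟨_, 1, rfl⟩

theorem cyclLen_le_of_isConj {g h : FreeGroup α} (hgh : IsConj g h) : cyclLen g ≤ cyclLen h := by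
  obtain ⟨c, rfl⟩ := isConj_iff.1 hgh
  obtain ⟨x, hx⟩ := exists_norm_conj_eq_cyclLen (c * g * c⁻¹)
  rw [← hx, show x * (c * g * c⁻¹) * x⁻¹ = (x * c) * g * (x * c)⁻¹ by group]
  exact cyclLen_le_norm_conj _ _

theorem cyclLen_eq_of_isConj {g h : FreeGroup α} (hgh : IsConj g h) : cyclLen g = cyclLen h :=
  le_antisymm (cyclLen_le_of_isConj hgh) (cyclLen_le_of_isConj hgh.symm)

theorem norm_mk_of_isReduced {w : List (α × Bool)} (hw : IsReduced w) :
    norm (mk w) = w.length := by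
  rw [FreeGroup.norm, toWord_mk, hw.reduce_eq]

theorem cyclLen_le_length_reduceCyclically {w : List (α × Bool)} (hw : IsReduced w) :
    cyclLen (mk w) ≤ (reduceCyclically w).length := by
  have h := congrArg (mk (α := α)) (reduceCyclically.conj_conjugator_reduceCyclically w)
  rw [← mul_mk, ← mul_mk, ← inv_mk] at h
  rw [← norm_mk_of_isReduced (reduceCyclically.isCyclicallyReduced hw).isReduced,
    ← cyclLen_eq_of_isConj (isConj_iff.2 ⟨_, h⟩)]
  simpa using cyclLen_le_norm_conj (mk (reduceCyclically w)) 1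

theorem isCyclicallyReduced_of_length_eq_cyclLen {w : List (α × Bool)} (hw : IsReduced w)
    (h : w.length = cyclLen (mk w)) : IsCyclicallyReduced w := by
  have hle := cyclLen_le_length_reduceCyclically hw
  have heq := reduceCyclically.conj_conjugator_reduceCyclically w
  have hlen := congrArg List.length heq
  simp only [List.length_append, invRev_length] at hlen
  have hnil : reduceCyclically.conjugator w = [] := List.eq_nil_of_length_eq_zero (by omega)
  rw [hnil] at heq
  have hr : reduceCyclically w = w := by simpa using heq
  exact hr ▸ reduceCyclically.isCyclicallyReduced hw

theorem mul_cyclLen_le_norm_pow (g : FreeGroup α) (n : ℕ) : n * cyclLen g ≤ norm (g ^ n) := by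
  cases n with
  | zero => simp
  | succ n =>
    have hr : IsReduced g.toWord := isReduced_toWord
    have hle := cyclLen_le_length_reduceCyclically hr
    rw [mk_toWord] at hle
    rw [FreeGroup.norm, toWord_pow, reduceCyclically.reduce_flatten_replicate_succ hr]
    simp only [List.length_append, List.length_flatten, List.map_replicate, List.sum_replicate,
      smul_eq_mul]
    have := Nat.mul_le_mul_left (n + 1) hle
    omega

theorem freeGroup_norm_pow_le (g : FreeGroup α) (n : ℕ) : norm (g ^ n) ≤ n * norm g := by
  induction n with
  | zero => simp
  | succ n ih =>
    rw [pow_succ]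
    have := norm_mul_le (g ^ n) g
    linarith

theorem exists_norm_pow_le (g : FreeGroup α) :
    ∃ C, ∀ n : ℕ, norm (g ^ n) ≤ n * cyclLen g + C := by
  obtain ⟨x, hx⟩ := exists_norm_conj_eq_cyclLen g
  refine ⟨2 * norm x, fun n => ?_⟩
  have h₁ := freeGroup_norm_pow_le (x * g * x⁻¹) n
  have h₂ := norm_mul_le (x⁻¹ * (x * g * x⁻¹) ^ n) x
  have h₃ := norm_mul_le x⁻¹ ((x * g * x⁻¹) ^ n)
  rw [show x⁻¹ * (x * g * x⁻¹) ^ n * x = g ^ n by rw [conj_pow]; group] at h₂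
  rw [norm_inv_eq] at h₃
  rw [hx] at h₁
  omega

end CyclLen

theorem eq_of_forall_abs_mul_sub_le {a b C : ℤ} (h : ∀ n : ℕ, |n * a - n * b| ≤ C) : a = b := by
  by_contra hab
  have h1 : 1 ≤ |a - b| := Int.one_le_abs (sub_ne_zero.2 hab)
  have h2 := h (C.toNat + 1)
  rw [← mul_sub, abs_mul, Nat.abs_cast] at h2
  have := Int.self_le_toNat C
  push_cast at h2
  nlinarith

/-- Lemma 2.1: for the Nielsen automorphism `φ = φ_{x,y}` (sending the letter `x` to
`x·y` and fixing all generators other than the one underlying `x`),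
`‖φ g‖ - ‖g‖ = n(ℓ; x) - 2 n(ℓ; x, y⁻¹)` for any cyclically reduced representative
`ℓ` of `g`. -/
theorem nielsen_length_change {k : ℕ} (hk : 2 ≤ k) (g : FreeGroup (Fin k)) (hg : g ≠ 1)
    (ℓ : List (Fin k × Bool)) (hℓ : IsCyclRep g ℓ)
    (x y : Fin k × Bool) (hxy : x.1 ≠ y.1)
    (φ : FreeGroup (Fin k) ≃* FreeGroup (Fin k))
    (hφx : φ (letterElt x) = letterElt x * letterElt y)
    (hφ : ∀ a : Fin k, a ≠ x.1 → φ (FreeGroup.of a) = FreeGroup.of a) :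
    (cyclLen (φ g) : ℤ) - (cyclLen g : ℤ) =
      (nLetter ℓ x.1 : ℤ) - 2 * (nPair ℓ x (letterInv y) : ℤ) := by
  obtain ⟨hred, hconj, hlen⟩ := hℓ
  have hℓr : IsReduced ℓ := isReduced_iff_reduce_eq.2 hred
  have hcyc := isCyclicallyReduced_of_length_eq_cyclLen hℓr
    (hlen.trans (cyclLen_eq_of_isConj hconj).symm)
  have hφconj : IsConj (φ (mk ℓ)) (φ g) := φ.toMonoidHom.map_isConj hconj
  rw [← cyclLen_eq_of_isConj hφconj, ← hlen, nPair_eq_pairCount]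
  obtain ⟨C, hC⟩ := exists_norm_pow_le (φ (mk ℓ))
  suffices h : (cyclLen (φ (mk ℓ)) : ℤ) = ℓ.length + nLetter ℓ x.1 -
      2 * pairCount x (letterInv y) ℓ.head? ℓ by linarith
  refine eq_of_forall_abs_mul_sub_le (C := C + 2) fun n => ?_
  have hn := norm_map_mk_add hxy hφx hφ (hcyc.flatten_replicate n).isReduced
  have hp := pairCount_le_pairCount_none x (letterInv y) ℓ.head? (List.replicate n ℓ).flatten
  rw [← pow_mk, map_pow, nLetter_flatten_replicate, List.length_flatten,
    List.map_replicate, List.sum_replicate, smul_eq_mul] at hn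
  rw [pairCount_flatten_replicate] at hp
  have hlow := mul_cyclLen_le_norm_pow (φ (mk ℓ)) n
  have hup := hC n
  zify at hn hp hlow hup
  rw [mul_sub, mul_add, abs_le]
  constructor <;> linarith
end

section
/- Let k be a natural number and let g ∈ FreeGroup (Fin k). Then the translation equivalence class of g is a union of finitely many conjugacy classes: the set {c : ConjClasses (FreeGroup (Fin k)) | ∃ h, c = ConjClasses.mk h ∧ h is translation equivalent to g} is finite. -/
/-- Translation equivalence (combinatorial form): equal cyclically reduced length
with respect to every free basis. -/
def TransEquiv {k : ℕ} (g h : FreeGroup (Fin k)) : Prop :=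
  ∀ φ : FreeGroup (Fin k) ≃* FreeGroup (Fin k), cyclLen (φ g) = cyclLen (φ h)

/-- The cyclically reduced length is attained by a conjugate. -/
theorem exists_conj_norm_eq_cyclLen {α : Type*} [DecidableEq α] (g : FreeGroup α) :
    ∃ x : FreeGroup α, FreeGroup.norm (x * g * x⁻¹) = cyclLen g :=
  Nat.sInf_mem (s := {n : ℕ | ∃ x : FreeGroup α, FreeGroup.norm (x * g * x⁻¹) = n}) ⟨_, 1, rfl⟩

/-- A free group on finitely many generators has finitely many elements of each norm. -/
theorem finite_setOf_norm_eq {α : Type*} [DecidableEq α] [Finite α] (n : ℕ) :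
    {g : FreeGroup α | FreeGroup.norm g = n}.Finite :=
  (List.finite_length_eq (α × Bool) n).preimage FreeGroup.toWord_injective.injOn

/-- Every translation equivalence class in a free group is a union of finitely many
conjugacy classes. -/
theorem translation_equivalence_class_finitely_many_conjugacy_classes {k : ℕ}
    (g : FreeGroup (Fin k)) :
    {c : ConjClasses (FreeGroup (Fin k)) |
      ∃ h : FreeGroup (Fin k), c = ConjClasses.mk h ∧ TransEquiv h g}.Finite := by
  refine ((finite_setOf_norm_eq (α := Fin k) (cyclLen g)).image ConjClasses.mk).subset ?_
  rintro _ ⟨h, rfl, hg⟩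
  obtain ⟨x, hx⟩ := exists_conj_norm_eq_cyclLen h
  exact ⟨x * h * x⁻¹, hx.trans (hg (MulEquiv.refl _)),
    ConjClasses.mk_eq_mk_iff_isConj.mpr (isConj_iff.mpr ⟨x, rfl⟩).symm⟩
end
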